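/- arXiv:2310.08100 — 3 statements merged into one kernel-verified Lean document; each statement's English description precedes it below -/
import Mathlib

section
/- (Proposition 1) The intrinsic Bellman operator T^π has a unique fixed point Q^π : S × A → ℝ, and for every initial function Q : S × A → ℝ the sequence of iterates (T^π)^k Q converges (in supremum norm, equivalently pointwise since S × A is finite) to Q^π as k → ∞. -/
open Finset

/-- The posterior ρ^π(a|s,φ) = K(φ|s,a)·π(a|s) / Σ_{a'} K(φ|s,a')·π(a'|s). -/
noncomputable def post {S A F : Type*} [Fintype A]
    (K : S → A → F → ℝ) (π : S → A → ℝ) (s : S) (a : A) (φ : F) : ℝ :=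
  K s a φ * π s a / ∑ a', K s a' φ * π s a'

/-- The intrinsic Bellman operator T^π. -/
noncomputable def bellman {S A F : Type*} [Fintype S] [Fintype A] [Fintype F]
    (P : S → A → S → ℝ) (K : S → A → F → ℝ) (r : S × A → ℝ) (γ η : ℝ)
    (π : S → A → ℝ) (Q : S × A → ℝ) : S × A → ℝ :=
  fun p => r p + γ * ∑ s', P p.1 p.2 s' * ∑ a', π s' a' * ∑ φ, K s' a' φ *
    (Q (s', a') + η * (Real.log (post K π s' a' φ) - Real.log (π s' a')))


/-- Averages of two functions that are `c`-close are `c`-close. -/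
theorem abs_weighted_sum_sub_le {ι : Type*} [Fintype ι] {w f g : ι → ℝ} {c : ℝ}
    (hw : ∀ i, 0 ≤ w i) (hsum : ∑ i, w i = 1) (h : ∀ i, |f i - g i| ≤ c) :
    |∑ i, w i * f i - ∑ i, w i * g i| ≤ c := by
  calc |∑ i, w i * f i - ∑ i, w i * g i| = |∑ i, w i * (f i - g i)| := by
        simp only [mul_sub, sum_sub_distrib]
    _ ≤ ∑ i, |w i * (f i - g i)| := abs_sum_le_sum_abs _ _
    _ ≤ ∑ i, w i * c := sum_le_sum fun i _ => by
        rw [abs_mul, abs_of_nonneg (hw i)]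
        exact mul_le_mul_of_nonneg_left (h i) (hw i)
    _ = c := by rw [← sum_mul, hsum, one_mul]

/-- The intrinsic Bellman operator is a contraction for the supremum metric, with the discount
factor as its constant. -/
theorem bellman_contractingWith {S A F : Type*} [Fintype S] [Fintype A] [Fintype F]
    {π : S → A → ℝ} (hπ : ∀ s a, 0 ≤ π s a) (hπsum : ∀ s, ∑ a, π s a = 1)
    {P : S → A → S → ℝ} (hP : ∀ s a s', 0 ≤ P s a s') (hPsum : ∀ s a, ∑ s', P s a s' = 1)
    {K : S → A → F → ℝ} (hK : ∀ s a φ, 0 ≤ K s a φ) (hKsum : ∀ s a, ∑ φ, K s a φ = 1)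
    (r : S × A → ℝ) {γ : ℝ} (hγ0 : 0 ≤ γ) (hγ1 : γ < 1) (η : ℝ) :
    ContractingWith ⟨γ, hγ0⟩ (bellman P K r γ η π) := by
  refine ⟨hγ1, LipschitzWith.of_dist_le_mul fun Q Q' => ?_⟩
  refine (dist_pi_le_iff (by positivity)).2 fun p => ?_
  simp only [bellman, dist_add_left]
  rw [Real.dist_eq, ← mul_sub, abs_mul, abs_of_nonneg hγ0]
  refine mul_le_mul_of_nonneg_left ?_ hγ0
  refine abs_weighted_sum_sub_le (hP _ _) (hPsum _ _) fun s' => ?_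
  refine abs_weighted_sum_sub_le (hπ _) (hπsum _) fun a' => ?_
  refine abs_weighted_sum_sub_le (hK _ _) (hKsum _ _) fun φ => ?_
  rw [add_sub_add_right_eq_sub, ← Real.dist_eq]
  exact dist_le_pi_dist Q Q' (s', a')

/-- Proposition 1: T^π has a unique fixed point Q^π and the iterates (T^π)^k Q
converge to Q^π for every initial Q. -/
theorem intrinsic_bellman_fixed_point
    {S A F : Type*} [Fintype S] [Fintype A] [Fintype F]
    [Nonempty S] [Nonempty A] [Nonempty F]
    (π : S → A → ℝ) (hπpos : ∀ s a, 0 < π s a) (hπsum : ∀ s, ∑ a, π s a = 1)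
    (P : S → A → S → ℝ) (hPpos : ∀ s a s', 0 ≤ P s a s')
    (hPsum : ∀ s a, ∑ s', P s a s' = 1)
    (K : S → A → F → ℝ) (hKpos : ∀ s a φ, 0 < K s a φ)
    (hKsum : ∀ s a, ∑ φ, K s a φ = 1)
    (r : S × A → ℝ) (γ : ℝ) (hγ0 : 0 ≤ γ) (hγ1 : γ < 1)
    (η : ℝ) (hη : 0 < η) :
    ∃ Qπ : S × A → ℝ,
      bellman P K r γ η π Qπ = Qπ ∧
      (∀ Q : S × A → ℝ, bellman P K r γ η π Q = Q → Q = Qπ) ∧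
      (∀ Q : S × A → ℝ,
        Filter.Tendsto (fun k => (bellman P K r γ η π)^[k] Q)
          Filter.atTop (nhds Qπ)) := by
  have hT := bellman_contractingWith (fun s a => (hπpos s a).le) hπsum hPpos hPsum
    (fun s a φ => (hKpos s a φ).le) hKsum r hγ0 hγ1 η
  exact ⟨hT.fixedPoint, hT.fixedPoint_isFixedPt, fun _ hQ => hT.fixedPoint_unique hQ,
    hT.tendsto_iterate_fixedPoint⟩
end

section
/- (Theorem 2, monotonic policy improvement) Let π be a positive policy with intrinsic action-value function Q^π (the unique fixed point of T^π), and define the improved policy π̃ by π̃(a|s) = exp( (Q^π(s,a) + η·Σ_φ K(φ|s,a)·log ρ^π(a|s,φ)) / η ) / Z^π(s), where Z^π(s) is the normalizing sum over a. Let Q^{π̃} be the unique fixed point of T^{π̃}. Then Q^{π̃}(s,a) ≥ Q^π(s,a) for all (s,a) ∈ S × A. -/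
open Finset

/-- Gibbs' inequality for finite positive weights of equal total mass. -/
theorem sum_mul_log_le_sum_mul_log {ι : Type*} [Fintype ι] (p q : ι → ℝ)
    (hp : ∀ i, 0 < p i) (hq : ∀ i, 0 < q i) (h : ∑ i, q i = ∑ i, p i) :
    ∑ i, p i * Real.log (q i) ≤ ∑ i, p i * Real.log (p i) := by
  have key : ∀ i, p i * Real.log (q i) - p i * Real.log (p i) ≤ q i - p i := by
    intro i
    have hl := Real.log_le_sub_one_of_pos (div_pos (hq i) (hp i))
    rw [Real.log_div (hq i).ne' (hp i).ne'] at hl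
    have hm := mul_le_mul_of_nonneg_left hl (hp i).le
    have he : p i * (q i / p i - 1) = q i - p i := by
      have := (hp i).ne'
      field_simp
    linarith
  have hs := Finset.sum_le_sum fun i (_ : i ∈ Finset.univ) => key i
  rw [Finset.sum_sub_distrib, Finset.sum_sub_distrib] at hs
  linarith

section Posterior

variable {S A F : Type*} [Fintype A] [Nonempty A] {K : S → A → F → ℝ} {π : S → A → ℝ}

theorem sum_kernel_mul_policy_pos (hK : ∀ s a φ, 0 < K s a φ) (hπ : ∀ s a, 0 < π s a)
    (s : S) (φ : F) : 0 < ∑ a, K s a φ * π s a :=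
  Finset.sum_pos (fun a _ => mul_pos (hK s a φ) (hπ s a)) Finset.univ_nonempty

theorem post_pos (hK : ∀ s a φ, 0 < K s a φ) (hπ : ∀ s a, 0 < π s a)
    (s : S) (a : A) (φ : F) : 0 < post K π s a φ :=
  div_pos (mul_pos (hK s a φ) (hπ s a)) (sum_kernel_mul_policy_pos hK hπ s φ)

theorem sum_post (hK : ∀ s a φ, 0 < K s a φ) (hπ : ∀ s a, 0 < π s a)
    (s : S) (φ : F) : ∑ a, post K π s a φ = 1 := by
  simp only [post]
  rw [← Finset.sum_div, div_self (sum_kernel_mul_policy_pos hK hπ s φ).ne']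

/-- Among the posteriors of positive policies, the one of the sampling policy `μ` maximizes the
expected log-likelihood of the action. -/
theorem sum_log_post_le [Fintype F] {μ : S → A → ℝ} (hK : ∀ s a φ, 0 < K s a φ)
    (hπ : ∀ s a, 0 < π s a) (hμ : ∀ s a, 0 < μ s a) (s : S) :
    ∑ a, μ s a * ∑ φ, K s a φ * Real.log (post K π s a φ) ≤
      ∑ a, μ s a * ∑ φ, K s a φ * Real.log (post K μ s a φ) := by
  simp only [Finset.mul_sum]
  rw [Finset.sum_comm, Finset.sum_comm (f := fun a φ => μ s a * (K s a φ * _))]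
  refine Finset.sum_le_sum fun φ _ => ?_
  have hD := sum_kernel_mul_policy_pos hK hμ s φ
  have hg := sum_mul_log_le_sum_mul_log (fun a => post K μ s a φ) (fun a => post K π s a φ)
    (fun a => post_pos hK hμ s a φ) (fun a => post_pos hK hπ s a φ)
    (by rw [sum_post hK hπ, sum_post hK hμ])
  have hw : ∀ a, ∀ x : ℝ, μ s a * (K s a φ * x) =
      (∑ a', K s a' φ * μ s a') * (post K μ s a φ * x) := by
    intro a x
    have := hD.ne'
    simp only [post]
    field_simp
  simp only [hw, ← Finset.mul_sum]
  exact mul_le_mul_of_nonneg_left hg hD.le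

end Posterior

/-- The soft value of a policy splits into action value, log-posterior and entropy. -/
theorem sum_policy_mul_sum_kernel {A F : Type*} [Fintype A] [Fintype F] (p q : A → ℝ)
    (k l : A → F → ℝ) (η : ℝ) (hk : ∀ a, ∑ φ, k a φ = 1) :
    ∑ a, p a * ∑ φ, k a φ * (q a + η * (Real.log (l a φ) - Real.log (p a))) =
      ∑ a, p a * q a + η * ∑ a, p a * ∑ φ, k a φ * Real.log (l a φ) -
        η * ∑ a, p a * Real.log (p a) := by
  rw [Finset.mul_sum, Finset.mul_sum, ← Finset.sum_add_distrib, ← Finset.sum_sub_distrib]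
  refine Finset.sum_congr rfl fun a _ => ?_
  have h : ∑ φ, k a φ * (q a + η * (Real.log (l a φ) - Real.log (p a))) =
      (∑ φ, k a φ) * (q a - η * Real.log (p a)) + η * ∑ φ, k a φ * Real.log (l a φ) := by
    rw [Finset.sum_mul, Finset.mul_sum, ← Finset.sum_add_distrib]
    exact Finset.sum_congr rfl fun φ _ => by ring
  rw [h, hk]
  ring

/-- The softmax of `f / η` maximizes the entropy-regularized expectation of `f`. -/
theorem entropy_regularized_le_softmax {A : Type*} [Fintype A] [Nonempty A] (f p q : A → ℝ)
    {η : ℝ} (hη : 0 < η) (hp : ∀ a, 0 < p a) (hp1 : ∑ a, p a = 1)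
    (hq : ∀ a, q a = Real.exp (f a / η) / ∑ a', Real.exp (f a' / η)) :
    (∀ a, 0 < q a) ∧ ∑ a, q a = 1 ∧
      ∑ a, p a * f a - η * ∑ a, p a * Real.log (p a) ≤
        ∑ a, q a * f a - η * ∑ a, q a * Real.log (q a) := by
  have hZ : 0 < ∑ a', Real.exp (f a' / η) :=
    Finset.sum_pos (fun a _ => Real.exp_pos _) Finset.univ_nonempty
  have hqpos : ∀ a, 0 < q a := fun a => by rw [hq]; exact div_pos (Real.exp_pos _) hZ
  have hq1 : ∑ a, q a = 1 := by
    simp only [hq]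
    rw [← Finset.sum_div, div_self hZ.ne']
  refine ⟨hqpos, hq1, ?_⟩
  have hf : ∀ a, f a = η * Real.log (q a) + η * Real.log (∑ a', Real.exp (f a' / η)) := by
    intro a
    rw [hq a, Real.log_div (Real.exp_pos _).ne' hZ.ne', Real.log_exp]
    have := hη.ne'
    field_simp
    ring
  have hexp : ∀ w : A → ℝ, ∑ a, w a = 1 → ∑ a, w a * f a =
      η * ∑ a, w a * Real.log (q a) + η * Real.log (∑ a', Real.exp (f a' / η)) := by
    intro w hw
    calc ∑ a, w a * f a
        = ∑ a, (η * (w a * Real.log (q a)) +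
            w a * (η * Real.log (∑ a', Real.exp (f a' / η)))) :=
          Finset.sum_congr rfl fun a _ => by
            conv_lhs => rw [hf a]
            ring
      _ = _ := by rw [Finset.sum_add_distrib, ← Finset.mul_sum, ← Finset.sum_mul, hw, one_mul]
  rw [hexp p hp1, hexp q hq1]
  have hg := sum_mul_log_le_sum_mul_log p q hp hqpos (by rw [hq1, hp1])
  have := mul_le_mul_of_nonneg_left hg hη.le
  linarith

/-- A function that lies below its image under the intrinsic Bellman operator lies below the
fixed point of that operator. -/
theorem le_of_le_bellman {S A F : Type*} [Fintype S] [Fintype A] [Fintype F]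
    [Nonempty S] [Nonempty A] {P : S → A → S → ℝ} (hPpos : ∀ s a s', 0 ≤ P s a s')
    (hPsum : ∀ s a, ∑ s', P s a s' = 1) {K : S → A → F → ℝ}
    (hKsum : ∀ s a, ∑ φ, K s a φ = 1) {r : S × A → ℝ} {γ : ℝ} (hγ0 : 0 ≤ γ) (hγ1 : γ < 1)
    {η : ℝ} {π : S → A → ℝ} (hπpos : ∀ s a, 0 < π s a) (hπsum : ∀ s, ∑ a, π s a = 1)
    {Q R : S × A → ℝ} (hQ : Q ≤ bellman P K r γ η π Q) (hR : bellman P K r γ η π R = R) :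
    Q ≤ R := by
  obtain ⟨p, hp⟩ := Finite.exists_min fun x => R x - Q x
  have hdiff : bellman P K r γ η π R p - bellman P K r γ η π Q p =
      γ * ∑ s', P p.1 p.2 s' * ∑ a', π s' a' * (R (s', a') - Q (s', a')) := by
    simp only [bellman]
    rw [add_sub_add_left_eq_sub, ← mul_sub, ← Finset.sum_sub_distrib]
    congr 1
    refine Finset.sum_congr rfl fun s' _ => ?_
    rw [← mul_sub]
    congr 1
    rw [sum_policy_mul_sum_kernel (π s') (fun a => R (s', a)) (K s') (post K π s') η (hKsum s'),
      sum_policy_mul_sum_kernel (π s') (fun a => Q (s', a)) (K s') (post K π s') η (hKsum s')]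
    simp only [mul_sub, Finset.sum_sub_distrib]
    ring
  have hmin : R p - Q p ≤ ∑ s', P p.1 p.2 s' * ∑ a', π s' a' * (R (s', a') - Q (s', a')) := by
    calc R p - Q p = ∑ s', P p.1 p.2 s' * ∑ a', π s' a' * (R p - Q p) := by
          simp only [← Finset.sum_mul, hπsum, hPsum, one_mul]
      _ ≤ _ := Finset.sum_le_sum fun s' _ => mul_le_mul_of_nonneg_left
          (Finset.sum_le_sum fun a' _ =>
            mul_le_mul_of_nonneg_left (hp (s', a')) (hπpos s' a').le) (hPpos _ _ _)
  have hγ := mul_le_mul_of_nonneg_left hmin hγ0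
  have hQp := hQ p
  have hm : 0 ≤ R p - Q p := by
    rw [hR] at hdiff
    nlinarith
  intro x
  have := hp x
  linarith

/-- Theorem 2 (monotonic policy improvement): if π̃ is the softmax-improved
policy built from the intrinsic action-value function Q^π and the posterior
ρ^π, then Q^{π̃} ≥ Q^π pointwise. -/
theorem intrinsic_policy_improvement
    {S A F : Type*} [Fintype S] [Fintype A] [Fintype F]
    [Nonempty S] [Nonempty A] [Nonempty F]
    (P : S → A → S → ℝ) (hPpos : ∀ s a s', 0 ≤ P s a s')
    (hPsum : ∀ s a, ∑ s', P s a s' = 1)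
    (K : S → A → F → ℝ) (hKpos : ∀ s a φ, 0 < K s a φ)
    (hKsum : ∀ s a, ∑ φ, K s a φ = 1)
    (r : S × A → ℝ) (γ : ℝ) (hγ0 : 0 ≤ γ) (hγ1 : γ < 1)
    (η : ℝ) (hη : 0 < η)
    (π : S → A → ℝ) (hπpos : ∀ s a, 0 < π s a) (hπsum : ∀ s, ∑ a, π s a = 1)
    (Qπ : S × A → ℝ) (hQπ : bellman P K r γ η π Qπ = Qπ)
    (πt : S → A → ℝ)
    (hπt : ∀ s a, πt s a =
      Real.exp ((Qπ (s, a) + η * ∑ φ, K s a φ * Real.log (post K π s a φ)) / η) /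
      ∑ a', Real.exp ((Qπ (s, a') + η * ∑ φ, K s a' φ * Real.log (post K π s a' φ)) / η))
    (Qπt : S × A → ℝ) (hQπt : bellman P K r γ η πt Qπt = Qπt) :
    ∀ s a, Qπ (s, a) ≤ Qπt (s, a) := by
  have hsoft := fun s => entropy_regularized_le_softmax
    (fun a => Qπ (s, a) + η * ∑ φ, K s a φ * Real.log (post K π s a φ))
    (π s) (πt s) hη (hπpos s) (hπsum s) (hπt s)
  have hπtpos : ∀ s a, 0 < πt s a := fun s => (hsoft s).1
  have himp : Qπ ≤ bellman P K r γ η πt Qπ := by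
    conv_lhs => rw [← hQπ]
    intro p
    simp only [bellman]
    refine add_le_add_right (mul_le_mul_of_nonneg_left (Finset.sum_le_sum fun s _ =>
      mul_le_mul_of_nonneg_left ?_ (hPpos _ _ _)) hγ0) _
    rw [sum_policy_mul_sum_kernel (π s) (fun a => Qπ (s, a)) (K s) (post K π s) η (hKsum s),
      sum_policy_mul_sum_kernel (πt s) (fun a => Qπ (s, a)) (K s) (post K πt s) η (hKsum s)]
    have hle := (hsoft s).2.2
    simp only [mul_add, Finset.sum_add_distrib, mul_left_comm _ η, ← Finset.mul_sum] at hle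
    have hpost := mul_le_mul_of_nonneg_left (sum_log_post_le hKpos hπpos hπtpos s) hη.le
    linarith
  exact fun s a => le_of_le_bellman hPpos hPsum hKsum hγ0 hγ1 hπtpos (fun s => (hsoft s).2.1)
    himp hQπt (s, a)
end

section
/- (Equation (41)) Let A and F be finite nonempty types, let π̃ and π be strictly positive probability mass functions on A, and let K assign to each a ∈ A a strictly positive probability mass function K(·|a) on F. For a probability mass function ν on A define the posterior ρ^ν(a|φ) = K(φ|a)·ν(a) / Σ_{a'} K(φ|a')·ν(a'). Then Σ_{a,φ} π̃(a)·K(φ|a)·log( ρ^π(a|φ) / π̃(a) ) ≤ Σ_{a,φ} π̃(a)·K(φ|a)·log( ρ^{π̃}(a|φ) / π̃(a) ). -/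
open Finset

/-- Gibbs' inequality for unnormalized positive weights, relative to a positive reference `p`:
among normalized weights, `w` itself maximizes the `w`-averaged log-likelihood ratio. -/
theorem sum_mul_log_normalized_div_le {A : Type*} [Fintype A] [Nonempty A] {w q p : A → ℝ}
    (hw : ∀ a, 0 < w a) (hq : ∀ a, 0 < q a) (hp : ∀ a, 0 < p a) :
    ∑ a, w a * Real.log ((q a / ∑ b, q b) / p a) ≤
      ∑ a, w a * Real.log ((w a / ∑ b, w b) / p a) := by
  have hQ : 0 < ∑ b, q b := sum_pos (fun b _ => hq b) univ_nonempty
  have hW : 0 < ∑ b, w b := sum_pos (fun b _ => hw b) univ_nonempty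
  set Q := ∑ b, q b
  set W := ∑ b, w b
  have key : ∀ a, w a * Real.log ((q a / Q) / p a) ≤
      w a * Real.log ((w a / W) / p a) + (W * (q a / Q) - w a) := by
    intro a
    have hwa := hw a
    have hqa := hq a
    have hpa := hp a
    have hlog := Real.log_le_sub_one_of_pos
      (show 0 < ((q a / Q) / p a) / ((w a / W) / p a) by positivity)
    rw [Real.log_div (by positivity) (by positivity)] at hlog
    have hratio : w a * (((q a / Q) / p a) / ((w a / W) / p a)) = W * (q a / Q) := by
      field_simp
    nlinarith [mul_le_mul_of_nonneg_left hlog hwa.le]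
  have hcancel : ∑ a, (W * (q a / Q) - w a) = 0 := by
    rw [sum_sub_distrib, ← mul_sum, ← sum_div, div_self hQ.ne', mul_one, sub_self]
  calc
    _ ≤ ∑ a, (w a * Real.log ((w a / W) / p a) + (W * (q a / Q) - w a)) :=
      sum_le_sum fun a _ => key a
    _ = _ := by rw [sum_add_distrib, hcancel, add_zero]

/-- Equation (41): replacing the mismatched posterior ρ^π by the matched
posterior ρ^{π̃} can only increase the mutual-information-like quantity. -/
theorem matched_posterior_dominates
    {A F : Type*} [Fintype A] [Fintype F] [Nonempty A] [Nonempty F]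
    (πt π : A → ℝ)
    (hπtpos : ∀ a, 0 < πt a) (hπtsum : ∑ a, πt a = 1)
    (hπpos : ∀ a, 0 < π a) (hπsum : ∑ a, π a = 1)
    (K : A → F → ℝ) (hKpos : ∀ a φ, 0 < K a φ) (hKsum : ∀ a, ∑ φ, K a φ = 1) :
    ∑ a, ∑ φ, πt a * K a φ *
        Real.log ((K a φ * π a / ∑ a', K a' φ * π a') / πt a) ≤
    ∑ a, ∑ φ, πt a * K a φ *
        Real.log ((K a φ * πt a / ∑ a', K a' φ * πt a') / πt a) := by
  rw [sum_comm, sum_comm (f := fun a φ => πt a * K a φ *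
    Real.log ((K a φ * πt a / ∑ a', K a' φ * πt a') / πt a))]
  refine sum_le_sum fun φ _ => ?_
  simpa only [mul_comm (πt _)] using sum_mul_log_normalized_div_le
    (w := fun a => K a φ * πt a) (q := fun a => K a φ * π a) (p := πt)
    (fun a => mul_pos (hKpos a φ) (hπtpos a)) (fun a => mul_pos (hKpos a φ) (hπpos a)) hπtpos
end
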